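/- Let Γ be a finite connected non-complete graph of prime valency p that is 2-geodesic transitive but not 2-arc transitive. Then Γ has exactly 2p+2 vertices. -/

import Mathlib

open SimpleGraph

/-- `Γ` is arc transitive: its automorphism group is transitive on ordered pairs
of adjacent vertices. -/
def ArcTransitive {V : Type*} (Γ : SimpleGraph V) : Prop :=
  ∀ ⦃v u v' u' : V⦄, Γ.Adj v u → Γ.Adj v' u' →
    ∃ φ : Γ ≃g Γ, φ v = v' ∧ φ u = u'

/-- `(v,u,w)` is a 2-arc of `Γ`. -/
def Is2Arc {V : Type*} (Γ : SimpleGraph V) (v u w : V) : Prop :=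
  Γ.Adj v u ∧ Γ.Adj u w ∧ v ≠ w

/-- `(v,u,w)` is a 2-geodesic of `Γ`: a 2-arc with `v`, `w` non-adjacent. -/
def Is2Geodesic {V : Type*} (Γ : SimpleGraph V) (v u w : V) : Prop :=
  Γ.Adj v u ∧ Γ.Adj u w ∧ v ≠ w ∧ ¬ Γ.Adj v w

/-- `Γ` is 2-arc transitive: arc transitive and transitive on 2-arcs. -/
def TwoArcTransitive {V : Type*} (Γ : SimpleGraph V) : Prop :=
  ArcTransitive Γ ∧
  ∀ ⦃v u w v' u' w' : V⦄, Is2Arc Γ v u w → Is2Arc Γ v' u' w' →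
    ∃ φ : Γ ≃g Γ, φ v = v' ∧ φ u = u' ∧ φ w = w'

/-- `Γ` is 2-geodesic transitive: arc transitive and transitive on 2-geodesics. -/
def TwoGeodesicTransitive {V : Type*} (Γ : SimpleGraph V) : Prop :=
  ArcTransitive Γ ∧
  ∀ ⦃v u w v' u' w' : V⦄, Is2Geodesic Γ v u w → Is2Geodesic Γ v' u' w' →
    ∃ φ : Γ ≃g Γ, φ v = v' ∧ φ u = u' ∧ φ w = w'

open Polynomial in
/-- Summing a polynomial over a translate of a finite set, in terms of power sums. -/
theorem sum_eval_add_eq {R : Type*} [CommRing R] (U : Finset R) (P : R[X]) (x : R) :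
    ∑ u ∈ U, P.eval (x + u) =
      ∑ i ∈ Finset.range (P.natDegree + 1), (hasseDeriv i P).eval x * ∑ u ∈ U, u ^ i := by
  have h : ∀ u, P.eval (x + u) =
      ∑ i ∈ Finset.range (P.natDegree + 1), (hasseDeriv i P).eval x * u ^ i := by
    intro u
    rw [add_comm, ← taylor_eval, eval_eq_sum_range, natDegree_taylor]
    simp only [taylor_coeff]
  simp only [h, Finset.mul_sum]
  exact Finset.sum_comm

open Polynomial in
theorem exists_powerSum_ne_zero {p : ℕ} [Fact p.Prime] {U : Finset (ZMod p)} (h0 : 0 ∉ U)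
    (hU : U.Nonempty) (hUp : U.card < p) :
    ∃ i, 1 ≤ i ∧ i ≤ U.card ∧ ∑ u ∈ U, u ^ i ≠ 0 := by
  by_contra! hcon
  set P : (ZMod p)[X] := ∏ u ∈ U, (X - C u) with hP
  have hdeg : P.natDegree = U.card := by
    rw [hP, natDegree_prod_of_monic _ _ fun u _ => monic_X_sub_C u]; simp
  have hsum : ∑ u ∈ U, P.eval (0 + u) = 0 := by
    refine Finset.sum_eq_zero fun u hu => ?_
    rw [hP, eval_prod]
    exact Finset.prod_eq_zero hu (by simp)
  rw [sum_eval_add_eq, Finset.sum_range_succ'] at hsum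
  rw [Finset.sum_eq_zero] at hsum
  · have hc : (U.card : ZMod p) ≠ 0 := by
      rw [Ne, ZMod.natCast_eq_zero_iff]
      exact Nat.not_dvd_of_pos_of_lt hU.card_pos hUp
    have hP0 : P.eval 0 ≠ 0 := by
      rw [hP, eval_prod, Finset.prod_ne_zero_iff]
      intro u hu h
      simp only [eval_sub, eval_X, eval_C, zero_sub, neg_eq_zero] at h
      exact h0 (h ▸ hu)
    simp [hc, hP0] at hsum
  · intro i hi
    rw [hcon (i + 1) (by omega) (by simp at hi; omega), mul_zero]

open Polynomial in
/-- If `k` is the least positive exponent with nonzero power sum over `U`, then the difference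
operator of `U` kills exactly the polynomials of degree less than `k`. -/
theorem natDegree_lt_of_sum_eval_add {p : ℕ} [Fact p.Prime] {U : Finset (ZMod p)} {k : ℕ}
    (hk : 1 ≤ k) (hmin : ∀ i, 1 ≤ i → i < k → ∑ u ∈ U, u ^ i = 0) (hne : ∑ u ∈ U, u ^ k ≠ 0)
    {P : (ZMod p)[X]} (hd : P.natDegree < p)
    (h : ∀ x, ∑ u ∈ U, P.eval (x + u) = U.card * P.eval x) : P.natDegree < k := by
  by_contra! hkd
  set d := P.natDegree with hd'
  set Q : (ZMod p)[X] := ∑ i ∈ Finset.range d, hasseDeriv (i + 1) P * C (∑ u ∈ U, u ^ (i + 1))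
    with hQ
  have hQ0 : Q = 0 := by
    have hdegQ : Q.natDegree < p := by
      refine lt_of_le_of_lt (natDegree_sum_le_of_forall_le _ _ fun i _ => ?_) hd
      refine (natDegree_mul_C_le _ _).trans ((natDegree_hasseDeriv_le _ _).trans (Nat.sub_le _ _))
    refine eq_zero_of_natDegree_lt_card_of_eval_eq_zero Q (f := id) Function.injective_id ?_
      (by simpa [ZMod.card] using hdegQ)
    intro x
    have hx := h x
    rw [sum_eval_add_eq, Finset.sum_range_succ'] at hx
    simp only [hasseDeriv_zero', pow_zero, Finset.sum_const, nsmul_eq_mul, mul_one] at hx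
    rw [mul_comm (eval x P), add_eq_right] at hx
    simpa [hQ, eval_finsetSum] using hx
  have hcoeff : Q.coeff (d - k) = 0 := by rw [hQ0, coeff_zero]
  rw [hQ, finsetSum_coeff, Finset.sum_eq_single (k - 1)] at hcoeff
  · rw [coeff_mul_C, hasseDeriv_coeff, Nat.sub_add_cancel hk, Nat.sub_add_cancel hkd] at hcoeff
    have hP0 : P.coeff d ≠ 0 := by
      rw [hd', coeff_natDegree]
      rintro hz
      rw [leadingCoeff_eq_zero] at hz
      rw [hz, natDegree_zero] at hd'
      omega
    have hch : ((d.choose k : ℕ) : ZMod p) ≠ 0 := by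
      rw [Ne, ZMod.natCast_eq_zero_iff]
      intro hdvd
      have := (Nat.Prime.dvd_factorial (Fact.out : p.Prime)).1
        ((hdvd.mul_right (k.factorial)).mul_right ((d - k).factorial) |>.trans
          (Nat.choose_mul_factorial_mul_factorial hkd).dvd)
      omega
    exact mul_ne_zero (mul_ne_zero hch hP0) hne hcoeff
  · intro i hi hik
    rw [coeff_mul_C, hasseDeriv_coeff]
    rcases lt_or_ge (i + 1) k with hlt | hge
    · rw [hmin (i + 1) (by omega) hlt, mul_zero]
    · rw [coeff_eq_zero_of_natDegree_lt (by omega)]; simp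
  · intro hk'
    simp only [Finset.mem_range, not_lt] at hk'
    omega

open Polynomial in
theorem sum_eval_add_of_natDegree_lt {R : Type*} [CommRing R] {U : Finset R} {k : ℕ}
    (hmin : ∀ i, 1 ≤ i → i < k → ∑ u ∈ U, u ^ i = 0)
    {P : R[X]} (hd : P.natDegree < k) (x : R) :
    ∑ u ∈ U, P.eval (x + u) = U.card * P.eval x := by
  rw [sum_eval_add_eq, Finset.sum_range_succ', Finset.sum_eq_zero]
  · simp [mul_comm]
  · intro i hi
    rw [hmin (i + 1) (by omega) (by simp at hi; omega), mul_zero]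

open Polynomial in
theorem affine_of_sub_mem_of_card_lt {p : ℕ} [Fact p.Prime] {U : Finset (ZMod p)} (h0 : 0 ∉ U)
    (hU : U.Nonempty) (hUp : 2 * U.card < p) (π : Equiv.Perm (ZMod p))
    (h : ∀ x y, π x - π y ∈ U ↔ x - y ∈ U) : ∃ a b, ∀ x, π x = a * x + b := by
  classical
  have hcomm : ∀ (g : ZMod p → ZMod p) x, ∑ u ∈ U, g (π (x + u)) = ∑ u ∈ U, g (π x + u) := by
    intro g x
    refine Finset.sum_bij' (fun u _ => π (x + u) - π x) (fun u _ => π.symm (π x + u) - x)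
      ?_ ?_ ?_ ?_ ?_
    · intro u hu; rw [h]; simpa using hu
    · intro u hu; rw [← h]; simpa using hu
    · intro u _; simp
    · intro u _; simp
    · intro u _; simp
  obtain ⟨f, hfd, hf⟩ : ∃ f : (ZMod p)[X], f.natDegree < p ∧ ∀ x, f.eval x = π x := by
    refine ⟨Lagrange.interpolate Finset.univ id π, ?_, fun x => ?_⟩
    · have := Lagrange.degree_interpolate_lt (s := Finset.univ) (v := id) (r := π)
        (Function.injective_id.injOn)
      rw [Finset.card_univ, ZMod.card] at this
      rcases eq_or_ne (Lagrange.interpolate Finset.univ id π) 0 with hz | hz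
      · rw [hz, natDegree_zero]; exact (Fact.out : p.Prime).pos
      · exact (natDegree_lt_iff_degree_lt hz).2 this
    · exact Lagrange.eval_interpolate_at_node (v := id) π Function.injective_id.injOn
        (Finset.mem_univ x)
  have hex := exists_powerSum_ne_zero h0 hU (by omega)
  have hex' : ∃ i, 1 ≤ i ∧ ∑ u ∈ U, u ^ i ≠ 0 := by
    obtain ⟨i, h1, _, h3⟩ := hex; exact ⟨i, h1, h3⟩
  obtain ⟨k, ⟨hk1, hkne⟩, hkmin⟩ : ∃ k, (1 ≤ k ∧ ∑ u ∈ U, u ^ k ≠ 0) ∧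
      ∀ i, 1 ≤ i → i < k → ∑ u ∈ U, u ^ i = 0 := by
    refine ⟨Nat.find hex', Nat.find_spec hex', fun i h1 hi => ?_⟩
    have := Nat.find_min hex' hi
    by_contra hne; exact this ⟨h1, hne⟩
  have hkU : k ≤ U.card := by
    obtain ⟨i, h1, h2, h3⟩ := hex
    by_contra! hlt
    exact h3 (hkmin i h1 (by omega))
  suffices hlin : f.natDegree ≤ 1 by
    refine ⟨f.coeff 1, f.coeff 0, fun x => ?_⟩
    rw [← hf, eq_X_add_C_of_natDegree_le_one hlin]
    simp
  have key : ∀ j, j < k → (f ^ j).natDegree < p → (f ^ j).natDegree < k := by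
    intro j hj hjp
    refine natDegree_lt_of_sum_eval_add hk1 hkmin hkne hjp fun x => ?_
    have h1 := sum_eval_add_of_natDegree_lt hkmin (P := X ^ j) (by simpa using hj) (π x)
    have h2 := hcomm (fun y => y ^ j) x
    simp only [eval_pow, eval_X] at h1
    simp only [eval_pow, hf]
    rw [h2, h1]
  rcases hk1.eq_or_lt with rfl | hk2
  · have hfX : (f - X).natDegree < 1 := by
      have hp2 := (Fact.out : p.Prime).two_le
      refine natDegree_lt_of_sum_eval_add le_rfl hkmin hkne ?_ fun x => ?_
      · refine lt_of_le_of_lt (natDegree_sub_le _ _) (max_lt hfd ?_)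
        rw [natDegree_X]; omega
      · have := hcomm id x
        simp only [id] at this
        simp only [eval_sub, eval_X, hf, Finset.sum_sub_distrib, this]
        rw [Finset.sum_add_distrib, Finset.sum_add_distrib, Finset.sum_const, Finset.sum_const]
        simp only [nsmul_eq_mul]
        ring
    have : f = (f - X) + X := by ring
    rw [this]
    refine (natDegree_add_le _ _).trans (max_le (by omega) natDegree_X_le)
  · by_contra! hn
    have hnk : f.natDegree < k := by simpa using key 1 hk2 (by simpa using hfd)
    set n := f.natDegree with hn'
    obtain ⟨j, hj1, hj2⟩ : ∃ j, k ≤ j * n ∧ j * n < k + n := by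
      refine ⟨(k + n - 1) / n, ?_, ?_⟩
      · have h1 := Nat.div_add_mod (k + n - 1) n
        have h2 := Nat.mod_lt (k + n - 1) (show n > 0 by omega)
        rw [mul_comm] at h1
        omega
      · have := Nat.div_mul_le_self (k + n - 1) n
        omega
    have hjk : j < k := by
      by_contra! hle
      have : k * n ≤ j * n := Nat.mul_le_mul_right n hle
      nlinarith
    have hdeg : (f ^ j).natDegree = j * n := natDegree_pow f j
    have := key j hjk (by omega)
    omega

/-- A permutation of `ZMod p` preserving a nontrivial difference set relation is affine
(the key step of Burnside's theorem on permutation groups of prime degree). -/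
theorem affine_of_sub_mem {p : ℕ} [Fact p.Prime] {U : Finset (ZMod p)} (h0 : 0 ∉ U)
    (hU : U.Nonempty) (hUc : ∃ t, t ≠ 0 ∧ t ∉ U) (π : Equiv.Perm (ZMod p))
    (h : ∀ x y, π x - π y ∈ U ↔ x - y ∈ U) : ∃ a b, ∀ x, π x = a * x + b := by
  classical
  rcases lt_or_ge (2 * U.card) p with hlt | hge
  · exact affine_of_sub_mem_of_card_lt h0 hU hlt π h
  · obtain ⟨t, ht0, htU⟩ := hUc
    have hmem : ∀ z, z ∈ (insert 0 U)ᶜ ↔ z ≠ 0 ∧ z ∉ U := by intro z; simp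
    refine affine_of_sub_mem_of_card_lt (U := (insert 0 U)ᶜ) (by simp)
      ⟨t, (hmem t).2 ⟨ht0, htU⟩⟩ ?_ π fun x y => ?_
    · rw [Finset.card_compl, ZMod.card, Finset.card_insert_of_notMem h0]
      have := (Fact.out : p.Prime).two_le
      omega
    · rw [hmem, hmem, h, sub_ne_zero, sub_ne_zero, π.injective.ne_iff]

/-- A transitive permutation group of prime degree contains a full cycle. -/
theorem exists_equiv_zmod_shift {N : Type*} [Finite N] {p : ℕ} [Fact p.Prime]
    (hN : Nat.card N = p) (H : Subgroup (Equiv.Perm N))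
    (htrans : ∀ x y, ∃ σ ∈ H, σ x = y) :
    ∃ e : ZMod p ≃ N, ∃ σ ∈ H, ∀ i, σ (e i) = e (i + 1) := by
  classical
  have := Fintype.ofFinite N
  have hcard : Fintype.card N = p := by rw [← hN, Nat.card_eq_fintype_card]
  have hprime : p.Prime := Fact.out
  obtain ⟨x₀⟩ : Nonempty N := Fintype.card_pos_iff.1 (hcard ▸ hprime.pos)
  have hpre : MulAction.IsPretransitive H N :=
    ⟨fun x y => by obtain ⟨σ, hσ, h⟩ := htrans x y; exact ⟨⟨σ, hσ⟩, h⟩⟩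
  have hdvd : p ∣ Nat.card H := by
    have h1 := MulAction.index_stabilizer_of_transitive H x₀
    rw [hN] at h1
    rw [← h1]
    exact Subgroup.index_dvd_card _
  obtain ⟨⟨σ, hσH⟩, hσ⟩ := exists_prime_orderOf_dvd_card' p hdvd
  rw [← Subgroup.orderOf_coe] at hσ
  simp only at hσ
  have hcyc : σ.IsCycle := Equiv.Perm.isCycle_of_prime_order'' (hcard.symm ▸ hprime) (by omega)
  have hsupp : σ.support = Finset.univ :=
    Finset.eq_univ_of_card _ (by rw [← hcyc.orderOf, hσ, hcard])
  have hmoved : ∀ x, σ x ≠ x := fun x => by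
    rw [← Equiv.Perm.mem_support, hsupp]; exact Finset.mem_univ x
  have hbij : Function.Bijective (fun i : ZMod p => (σ ^ i.val) x₀) := by
    rw [Fintype.bijective_iff_surjective_and_card]
    refine ⟨fun y => ?_, by rw [ZMod.card, hcard]⟩
    obtain ⟨i, hi⟩ := hcyc.exists_pow_eq (hmoved x₀) (hmoved y)
    refine ⟨i, ?_⟩
    simp only [ZMod.val_natCast]
    rw [← hσ, pow_mod_orderOf, hi]
  refine ⟨Equiv.ofBijective _ hbij, σ, hσH, fun i => ?_⟩
  simp only [Equiv.ofBijective_apply]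
  rw [ZMod.val_add, ZMod.val_one, ← Equiv.Perm.mul_apply, ← pow_succ']
  have hmod := pow_mod_orderOf σ (i.val + 1)
  rw [hσ] at hmod
  rw [hmod]

theorem pow_card_eq_one_of_mul_mem {F : Type*} [Field F] {S : Finset F} (h0 : 0 ∉ S) {a : F}
    (ha : a ≠ 0) (h : ∀ x ∈ S, a * x ∈ S) : a ^ S.card = 1 := by
  have hinj : Set.InjOn (fun x => a * x) S := (mul_right_injective₀ ha).injOn
  have himg : ∏ x ∈ S, a * x = ∏ x ∈ S, x :=
    Finset.prod_nbij (fun x => a * x) h hinj (Finset.surjOn_of_injOn_of_card_le _ h hinj le_rfl)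
      fun _ _ => rfl
  rw [Finset.prod_mul_distrib, Finset.prod_const] at himg
  refine mul_right_cancel₀ (b := ∏ x ∈ S, x) ?_ (himg.trans (one_mul _).symm)
  rw [Finset.prod_ne_zero_iff]
  rintro x hx rfl
  exact h0 hx

theorem card_filter_pow_eq_le {F : Type*} [Field F] [Fintype F] [DecidableEq F] {k : ℕ}
    (hk : 0 < k) (a : F) : (Finset.univ.filter fun x : F => x ^ k = a).card ≤ k := by
  have : (Finset.univ.filter fun x : F => x ^ k = a) = Polynomial.nthRootsFinset k a := by
    ext x; simp [Polynomial.mem_nthRootsFinset hk]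
  rw [this, Polynomial.nthRootsFinset_def]
  exact (Multiset.toFinset_card_le _).trans (Polynomial.card_nthRoots k a)

/-- A set of nonzero residues that is homogeneous under multiplications is a coset of a group of
roots of unity. -/
theorem exists_mem_iff_pow_eq {p : ℕ} [Fact p.Prime] {S : Finset (ZMod p)} (h0 : 0 ∉ S)
    (hne : S.Nonempty) (h : ∀ d ∈ S, ∀ d' ∈ S, ∃ a, a * d = d' ∧ ∀ x ∈ S, a * x ∈ S) :
    S.card ∣ p - 1 ∧ ∃ ε : ZMod p, ε ≠ 0 ∧ ∀ x, x ∈ S ↔ x ^ S.card = ε := by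
  obtain ⟨d, hd⟩ := hne
  have hd0 : d ≠ 0 := fun hz => h0 (hz ▸ hd)
  have hpow : ∀ n, (∀ a : ZMod p, a ≠ 0 → (∀ x ∈ S, a * x ∈ S) → a ^ n = 1) → 0 < n →
      S.card ≤ n ∧ ∀ x ∈ S, x ^ n = d ^ n := by
    intro n hn hn0
    have key : ∀ x ∈ S, x ^ n = d ^ n := by
      intro x hx
      obtain ⟨a, rfl, ha⟩ := h d hd x hx
      rw [mul_pow, hn a (left_ne_zero_of_mul fun hz => h0 (hz ▸ hx)) ha, one_mul]
    refine ⟨le_trans (Finset.card_le_card fun x hx => ?_) (card_filter_pow_eq_le hn0 (d ^ n)), key⟩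
    simpa using key x hx
  have hcardpos : 0 < S.card := Finset.card_pos.2 ⟨d, hd⟩
  have h1 := hpow S.card (fun a ha haS => pow_card_eq_one_of_mul_mem h0 ha haS) hcardpos
  have h2 := hpow (Nat.gcd S.card (p - 1))
    (fun a ha haS => pow_gcd_eq_one.2
        ⟨pow_card_eq_one_of_mul_mem h0 ha haS, ZMod.pow_card_sub_one_eq_one ha⟩)
      (Nat.gcd_pos_of_pos_left _ hcardpos)
  refine ⟨?_, d ^ S.card, pow_ne_zero _ hd0, fun x => ?_⟩
  · have := (Nat.gcd_le_left (p - 1) hcardpos).antisymm h2.1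
    rw [← this]; exact Nat.gcd_dvd_right _ _
  · have hsub : S ⊆ Finset.univ.filter fun x => x ^ S.card = d ^ S.card := by
      intro y hy; simpa using h1.2 y hy
    have := Finset.eq_of_subset_of_card_le hsub (card_filter_pow_eq_le hcardpos _)
    constructor
    · exact h1.2 x
    · intro hx; rw [this]; simpa using hx

section PaleyCounting

variable {p k : ℕ} [Fact p.Prime]

theorem pow_eq_or_eq_neg {ε x : ZMod p} (hpk : p = 2 * k + 1) (hε : ε ^ 2 = 1) (hx : x ≠ 0) :
    x ^ k = ε ∨ x ^ k = -ε := by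
  have h1 : (x ^ k) ^ 2 = ε ^ 2 := by
    rw [hε, ← pow_mul, ← ZMod.pow_card_sub_one_eq_one hx]
    congr 1; omega
  exact sq_eq_sq_iff_eq_or_eq_neg.1 h1

theorem neg_ne_self_of_sq_eq_one {ε : ZMod p} (hpk : p = 2 * k + 1) (hε : ε ^ 2 = 1) :
    -ε ≠ ε := by
  intro h
  have hne : ε ≠ 0 := by rintro rfl; simp at hε
  have h2 : (2 : ZMod p) * ε = 0 := by linear_combination -h
  rcases mul_eq_zero.1 h2 with h3 | h3
  · have : ((2 : ℕ) : ZMod p) = 0 := by exact_mod_cast h3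
    rw [ZMod.natCast_eq_zero_iff] at this
    have h4 := Nat.le_of_dvd (by norm_num) this
    have := (Fact.out : p.Prime).two_le
    omega
  · exact hne h3

theorem card_filter_pow_eq_neg {ε : ZMod p} (hpk : p = 2 * k + 1) (hk : k ≠ 0) (hε : ε ^ 2 = 1)
    (hcard : (Finset.univ.filter fun x : ZMod p => x ^ k = ε).card = k) :
    (Finset.univ.filter fun x : ZMod p => x ^ k = -ε).card = k := by
  have hne : ε ≠ 0 := by rintro rfl; simp at hε
  have hu : insert 0 ((Finset.univ.filter fun x : ZMod p => x ^ k = ε) ∪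
      (Finset.univ.filter fun x : ZMod p => x ^ k = -ε)) = Finset.univ := by
    ext x
    have := pow_eq_or_eq_neg (x := x) hpk hε
    simp only [Finset.mem_insert, Finset.mem_union, Finset.mem_filter, Finset.mem_univ, true_and,
      iff_true]
    tauto
  have hc := congrArg Finset.card hu
  rw [Finset.card_insert_of_notMem (by simp [zero_pow hk, hne, hne.symm]),
    Finset.card_union_of_disjoint,
    Finset.card_univ, ZMod.card, hcard] at hc
  · omega
  · rw [Finset.disjoint_filter]
    intro x _ h1 h2
    exact neg_ne_self_of_sq_eq_one hpk hε (h2.symm.trans h1)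

/-- Among the points `x` with `x ^ k = b`, compare distances to a point `d ≠ x`. -/
theorem card_filter_pow_add_card_filter_pow {ε b d : ZMod p} (hpk : p = 2 * k + 1)
    (hk : k ≠ 0) (hε : ε ^ 2 = 1)
    (hb : (Finset.univ.filter fun x : ZMod p => x ^ k = b).card = k) :
    (Finset.univ.filter fun x : ZMod p => x ^ k = b ∧ (x - d) ^ k = -ε).card +
      (Finset.univ.filter fun x : ZMod p => x ^ k = b ∧ (x - d) ^ k = ε).card +
      (if d ^ k = b then 1 else 0) = k := by
  have hne : ε ≠ 0 := by rintro rfl; simp at hε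
  have h1 : (if d ^ k = b then 1 else 0) =
      (Finset.univ.filter fun x : ZMod p => x ^ k = b ∧ x = d).card := by
    split_ifs with h
    · rw [eq_comm, Finset.card_eq_one]
      refine ⟨d, ?_⟩
      ext x
      simp only [Finset.mem_filter, Finset.mem_univ, true_and, Finset.mem_singleton,
        and_iff_right_iff_imp]
      rintro rfl; exact h
    · rw [eq_comm, Finset.card_eq_zero, Finset.filter_eq_empty_iff]
      rintro x - ⟨h2, rfl⟩
      exact h h2
  rw [h1, ← Finset.card_union_of_disjoint, ← Finset.card_union_of_disjoint]
  · rw [← Finset.filter_or, ← Finset.filter_or]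
    refine Eq.trans (congrArg Finset.card (Finset.filter_congr fun x _ => ?_)) hb
    have := pow_eq_or_eq_neg (x := x - d) hpk hε
    rw [sub_ne_zero] at this
    tauto
  · rw [← Finset.filter_or, Finset.disjoint_filter]
    rintro x - h2 ⟨-, rfl⟩
    rw [sub_self, zero_pow hk] at h2
    rcases h2 with h2 | h2
    · exact hne (neg_eq_zero.1 h2.2.symm)
    · exact hne h2.2.symm
  · rw [Finset.disjoint_filter]
    intro x _ h1 h2
    exact neg_ne_self_of_sq_eq_one hpk hε (h1.2.symm.trans h2.2)

theorem card_swap {ε d : ZMod p} (hε : ε ^ 2 = 1) (hk : k ≠ 0) (hneg : (-1 : ZMod p) ^ k = 1)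
    (hd : d ^ k = ε) :
    (Finset.univ.filter fun x : ZMod p => x ^ k = -ε ∧ (x - d) ^ k = -ε).card =
      (Finset.univ.filter fun x : ZMod p => x ^ k = -ε ∧ (x - d) ^ k = ε).card := by
  have hne : ε ≠ 0 := by rintro rfl; simp at hε
  have hd0 : d ≠ 0 := by rintro rfl; exact hne (by rw [← hd, zero_pow hk])
  have hx0 : ∀ x : ZMod p, x ^ k = -ε → x ≠ 0 := by
    rintro x hx rfl; rw [zero_pow hk] at hx; exact hne (neg_eq_zero.1 hx.symm)
  have key : ∀ x : ZMod p, x ^ k = -ε →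
      (d ^ 2 / x) ^ k = -ε ∧ (d ^ 2 / x - d) ^ k = -(x - d) ^ k := by
    intro x hx
    have h0 := hx0 x hx
    constructor
    · rw [div_pow, hx, ← pow_mul, mul_comm, pow_mul, hd, div_neg, sq, mul_div_assoc, div_self hne,
        mul_one]
    · have : d ^ 2 / x - d = -1 * (d * (x - d) / x) := by field_simp; ring
      rw [this, mul_pow, hneg, div_pow, mul_pow, hd, hx]
      field_simp
  have hinv : ∀ x : ZMod p, x ^ k = -ε → d ^ 2 / (d ^ 2 / x) = x := by
    intro x hx; have h0 := hx0 x hx; field_simp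
  refine Finset.card_nbij' (fun x => d ^ 2 / x) (fun x => d ^ 2 / x) ?_ ?_ ?_ ?_
  · intro x hx
    simp only [Finset.coe_filter, Finset.mem_univ, true_and, Set.mem_ofPred_eq] at hx ⊢
    exact ⟨(key x hx.1).1, by rw [(key x hx.1).2, hx.2, neg_neg]⟩
  · intro x hx
    simp only [Finset.coe_filter, Finset.mem_univ, true_and, Set.mem_ofPred_eq] at hx ⊢
    exact ⟨(key x hx.1).1, by rw [(key x hx.1).2, hx.2]⟩
  · intro x hx
    simp only [Finset.coe_filter, Finset.mem_univ, true_and, Set.mem_ofPred_eq] at hx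
    exact hinv x hx.1
  · intro x hx
    simp only [Finset.coe_filter, Finset.mem_univ, true_and, Set.mem_ofPred_eq] at hx
    exact hinv x hx.1

theorem card_swap_neg {ε d t : ZMod p} (hε : ε ^ 2 = 1) (hk : k ≠ 0)
    (hd : d ^ k = ε) (ht : t ^ k = -ε) :
    (Finset.univ.filter fun x : ZMod p => x ^ k = -ε ∧ (x - t) ^ k = ε).card =
      (Finset.univ.filter fun x : ZMod p => x ^ k = -ε ∧ (x - d) ^ k = -ε).card := by
  have hne : ε ≠ 0 := by rintro rfl; simp at hε
  have hd0 : d ≠ 0 := by rintro rfl; exact hne (by rw [← hd, zero_pow hk])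
  have h0 : ∀ x : ZMod p, x ^ k ≠ 0 → x ≠ 0 := by
    rintro x hx rfl; exact hx (zero_pow hk)
  have ht0 : t ≠ 0 := h0 t (by rw [ht]; exact neg_ne_zero.2 hne)
  refine Finset.card_nbij' (fun x => x * d / (x - t)) (fun y => t * y / (y - d)) ?_ ?_ ?_ ?_
  all_goals
    intro x hx
    simp only [Finset.coe_filter, Finset.mem_univ, true_and, Set.mem_ofPred_eq] at hx ⊢
    have hx1 : x ≠ 0 := h0 x (by rw [hx.1]; exact neg_ne_zero.2 hne)
  · have hx2 : x - t ≠ 0 := h0 _ (by rw [hx.2]; exact hne)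
    have : x * d / (x - t) - d = t * d / (x - t) := by field_simp; ring
    rw [this, div_pow, div_pow, mul_pow, mul_pow, hx.1, hx.2, hd, ht]
    constructor <;> field_simp
  · have hx2 : x - d ≠ 0 := h0 _ (by rw [hx.2]; exact neg_ne_zero.2 hne)
    have : t * x / (x - d) - t = t * d / (x - d) := by field_simp; ring
    rw [this, div_pow, div_pow, mul_pow, mul_pow, hx.1, hx.2, hd, ht]
    constructor <;> field_simp
  · have hx2 : x - t ≠ 0 := h0 _ (by rw [hx.2]; exact hne)
    have : x * d / (x - t) - d = t * d / (x - t) := by field_simp; ring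
    rw [this]
    field_simp
  · have hx2 : x - d ≠ 0 := h0 _ (by rw [hx.2]; exact neg_ne_zero.2 hne)
    have : t * x / (x - d) - t = t * d / (x - d) := by field_simp; ring
    rw [this]
    field_simp

/-- In the Paley-type graph on `ZMod p` joining `x`, `y` when `(x - y) ^ k = -ε`, two nonadjacent
points have `k / 2` common neighbours and two adjacent ones have `k / 2 - 1`. -/
theorem two_mul_card_common {ε d : ZMod p} (hpk : p = 2 * k + 1) (hk : k ≠ 0) (hε : ε ^ 2 = 1)
    (hcard : (Finset.univ.filter fun x : ZMod p => x ^ k = ε).card = k)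
    (hneg : (-1 : ZMod p) ^ k = 1) (hd : d ^ k = ε) :
    2 * (Finset.univ.filter fun x : ZMod p => x ^ k = -ε ∧ (x - d) ^ k = -ε).card = k := by
  have h1 := card_filter_pow_add_card_filter_pow (d := d) hpk hk hε
    (card_filter_pow_eq_neg hpk hk hε hcard)
  rw [if_neg, ← card_swap hε hk hneg hd] at h1
  · omega
  · rw [hd]; exact (neg_ne_self_of_sq_eq_one hpk hε).symm

theorem two_mul_card_common_neg {ε t : ZMod p} (hpk : p = 2 * k + 1) (hk : k ≠ 0) (hε : ε ^ 2 = 1)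
    (hcard : (Finset.univ.filter fun x : ZMod p => x ^ k = ε).card = k)
    (hneg : (-1 : ZMod p) ^ k = 1) (ht : t ^ k = -ε) :
    2 * (Finset.univ.filter fun x : ZMod p => x ^ k = -ε ∧ (x - t) ^ k = -ε).card + 2 = k := by
  obtain ⟨d, hd⟩ := Finset.card_pos.1 (hcard.symm ▸ Nat.pos_of_ne_zero hk)
  have hd : d ^ k = ε := by simpa using hd
  have h1 := card_filter_pow_add_card_filter_pow (d := t) hpk hk hε
    (card_filter_pow_eq_neg hpk hk hε hcard)
  rw [if_pos ht, card_swap_neg hε hk hd ht] at h1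
  have h2 := two_mul_card_common hpk hk hε hcard hneg hd
  omega

/-- A root of `x ^ k = -ε` is the sum of a root of `x ^ k = ε` and a root of `x ^ k = -ε`. -/
theorem exists_pow_eq_and_sub_pow_eq_neg {ε t : ZMod p} (hpk : p = 2 * k + 1) (hk : k ≠ 0)
    (hε : ε ^ 2 = 1)
    (hcard : (Finset.univ.filter fun x : ZMod p => x ^ k = ε).card = k)
    (hneg : (-1 : ZMod p) ^ k = 1) (ht : t ^ k = -ε) :
    ∃ s : ZMod p, s ^ k = ε ∧ (t - s) ^ k = -ε := by
  have hne : ε ≠ 0 := by rintro rfl; simp at hε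
  obtain ⟨d, hd⟩ := Finset.card_pos.1 (hcard.symm ▸ Nat.pos_of_ne_zero hk)
  have hd : d ^ k = ε := by simpa using hd
  have h2 := two_mul_card_common hpk hk hε hcard hneg hd
  obtain ⟨x, hx⟩ := Finset.card_pos.1 (show 0 < (Finset.univ.filter fun x : ZMod p =>
    x ^ k = -ε ∧ (x - d) ^ k = -ε).card by omega)
  obtain ⟨hx1, hx2⟩ : x ^ k = -ε ∧ (x - d) ^ k = -ε := by simpa using hx
  have hx0 : x ≠ 0 := by
    rintro rfl; rw [zero_pow hk] at hx1; exact hne (neg_eq_zero.1 hx1.symm)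
  refine ⟨d * t / x, ?_, ?_⟩
  · rw [div_pow, mul_pow, hd, ht, hx1]; field_simp
  · have : t - d * t / x = t * (x - d) / x := by field_simp
    rw [this, div_pow, mul_pow, ht, hx1, hx2]; field_simp

end PaleyCounting

/-- Coordinates on the neighbourhood of `v` by residues modulo `p`, in which nonadjacency is
given by a coset of the group of `k`-th roots of unity, and the stabilizer of `v` acts by affine
maps. -/
structure PaleyCoords {V : Type*} (Γ : SimpleGraph V) (v : V) (p k : ℕ) [NeZero p] where
  e : ZMod p ≃ Γ.neighborSet v
  ε : ZMod p
  ε_ne_zero : ε ≠ 0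
  card_eq : (Finset.univ.filter fun x : ZMod p => x ^ k = ε).card = k
  neg_one_pow : (-1 : ZMod p) ^ k = 1
  not_adj_iff : ∀ i j, i ≠ j → (¬ Γ.Adj (e i) (e j) ↔ (j - i) ^ k = ε)
  affine : ∀ φ : Γ ≃g Γ, φ v = v → ∃ a b : ZMod p, a ^ k = 1 ∧
    ∀ x, φ (e x) = (e (a * x + b) : V)

theorem exists_perm_neighborSet {V : Type*} {Γ : SimpleGraph V} {v : V} (φ : Γ ≃g Γ)
    (hφ : φ v = v) :
    ∃ σ : Equiv.Perm (Γ.neighborSet v), ∀ x : Γ.neighborSet v, φ x = (σ x : V) := by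
  have h : ∀ x, φ.toEquiv x ∈ Γ.neighborSet v ↔ x ∈ Γ.neighborSet v := by
    intro x
    simp only [mem_neighborSet]
    conv_rhs => rw [← φ.map_adj_iff, hφ]
    rfl
  exact ⟨Equiv.Perm.subtypePerm (φ.toEquiv : Equiv.Perm V) h, fun x => rfl⟩

theorem ArcTransitive.exists_cyclic_coords {V : Type*} [Finite V] {Γ : SimpleGraph V} {p : ℕ}
    [Fact p.Prime] (hat : ArcTransitive Γ) {v : V} (hv : Nat.card (Γ.neighborSet v) = p) :
    ∃ e : ZMod p ≃ Γ.neighborSet v, ∃ σ : Γ ≃g Γ, ∀ i, σ (e i) = (e (i + 1) : V) := by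
  let H : Subgroup (Equiv.Perm (Γ.neighborSet v)) :=
    { carrier := {σ | ∃ φ : Γ ≃g Γ, ∀ x : Γ.neighborSet v, φ x = (σ x : V)}
      mul_mem' := by
        rintro σ τ ⟨φ, h⟩ ⟨ψ, h'⟩
        exact ⟨φ * ψ, fun x => by
          rw [RelIso.mul_apply, h', h, Equiv.Perm.mul_apply]⟩
      one_mem' := ⟨1, fun x => rfl⟩
      inv_mem' := by
        rintro σ ⟨φ, h⟩
        refine ⟨φ⁻¹, fun x => ?_⟩
        apply φ.injective
        rw [RelIso.apply_inv_self, h]; simp }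
  have htrans : ∀ x y, ∃ σ ∈ H, σ x = y := by
    intro x y
    obtain ⟨φ, h1, h2⟩ := hat x.2 y.2
    obtain ⟨σ, hσ⟩ := exists_perm_neighborSet φ h1
    exact ⟨σ, ⟨φ, hσ⟩, Subtype.ext (by rw [← hσ, h2])⟩
  obtain ⟨e, σ, ⟨φ, hφ⟩, he⟩ := exists_equiv_zmod_shift hv H htrans
  exact ⟨e, φ, fun i => by rw [hφ, he]⟩

theorem adj_of_cyclic_coords {V : Type*} {Γ : SimpleGraph V} {p : ℕ}
    [NeZero p] {v : V} {e : ZMod p ≃ Γ.neighborSet v} {σ : Γ ≃g Γ}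
    (hσ : ∀ i, σ (e i) = (e (i + 1) : V)) (i j : ZMod p) :
    Γ.Adj (e i) (e j) ↔ Γ.Adj (e 0) (e (j - i)) := by
  have h : ∀ (n : ℕ) i j, Γ.Adj (e i) (e j) ↔ Γ.Adj (e (i + n)) (e (j + n)) := by
    intro n
    induction n with
    | zero => simp
    | succ n ih =>
      intro i j
      rw [ih, ← σ.map_adj_iff, hσ, hσ]
      push_cast
      rw [add_assoc, add_assoc]
  rw [h (-i).val i j, ZMod.natCast_zmod_val, add_neg_cancel, sub_eq_add_neg]

open Classical in
theorem TwoGeodesicTransitive.nonempty_paleyCoords {V : Type*} [Fintype V] {Γ : SimpleGraph V}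
    {p k : ℕ} [Fact p.Prime] (h2gt : TwoGeodesicTransitive Γ) {v : V}
    (hv : Nat.card (Γ.neighborSet v) = p) (hk0 : k ≠ 0) (hkp : k < p - 1)
    (hk : ∀ v u, Γ.Adj v u →
      (Finset.univ.filter fun w => Γ.Adj u w ∧ v ≠ w ∧ ¬ Γ.Adj v w).card = k) :
    k ∣ p - 1 ∧ Nonempty (PaleyCoords Γ v p k) := by
  obtain ⟨e, σ, hσ⟩ := h2gt.1.exists_cyclic_coords hv
  have hadj := adj_of_cyclic_coords hσ
  set S : Finset (ZMod p) := Finset.univ.filter fun d => d ≠ 0 ∧ ¬ Γ.Adj (e 0) (e d) with hS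
  have memS : ∀ d, d ∈ S ↔ d ≠ 0 ∧ ¬ Γ.Adj (e 0) (e d) := by intro d; simp [hS]
  have h0 : (0 : ZMod p) ∉ S := by simp [memS]
  have hnadj : ∀ i j, i ≠ j → (¬ Γ.Adj (e i) (e j) ↔ j - i ∈ S) := by
    intro i j hij
    rw [memS, hadj, sub_ne_zero]
    exact ⟨fun h => ⟨hij.symm, h⟩, fun h => h.2⟩
  have hSk : S.card = k := by
    rw [← hk _ _ (e 0).2.symm]
    refine Finset.card_bij (fun d _ => (e d : V)) ?_ ?_ ?_
    · intro d hd
      rw [memS] at hd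
      simp only [Finset.mem_filter, Finset.mem_univ, true_and]
      exact ⟨(e d).2, fun h => hd.1 (e.injective (Subtype.ext h)).symm, hd.2⟩
    · intro d _ d' _ h
      exact e.injective (Subtype.ext h)
    · intro w hw
      simp only [Finset.mem_filter, Finset.mem_univ, true_and] at hw
      refine ⟨e.symm ⟨w, hw.1⟩, ?_, by simp⟩
      rw [memS]
      refine ⟨fun h => hw.2.1 ?_, by simpa using hw.2.2⟩
      rw [← h]; simp
  have hne : S.Nonempty := Finset.card_pos.1 (by omega)
  have hSc : ∃ t, t ≠ 0 ∧ t ∉ S := by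
    by_contra! hcon
    have : insert 0 S = Finset.univ := by
      ext x; simp only [Finset.mem_insert, Finset.mem_univ, iff_true]
      by_cases hx : x = 0
      · exact Or.inl hx
      · exact Or.inr (hcon x hx)
    have hc := congrArg Finset.card this
    rw [Finset.card_insert_of_notMem h0, Finset.card_univ, ZMod.card] at hc
    omega
  have haff : ∀ φ : Γ ≃g Γ, φ v = v → ∃ a b : ZMod p, a ≠ 0 ∧ (∀ x ∈ S, a * x ∈ S) ∧
      ∀ x, φ (e x) = (e (a * x + b) : V) := by
    intro φ hφ
    obtain ⟨τ, hτ⟩ := exists_perm_neighborSet φ hφ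
    set π : Equiv.Perm (ZMod p) := (e.trans τ).trans e.symm with hπ
    have hπe : ∀ x, φ (e x) = (e (π x) : V) := by intro x; rw [hτ]; simp [hπ]
    have hpres : ∀ x y, π x - π y ∈ S ↔ x - y ∈ S := by
      intro x y
      by_cases hxy : y = x
      · subst hxy; simp [h0]
      · rw [← hnadj _ _ hxy, ← hnadj _ _ (π.injective.ne hxy), ← hπe, ← hπe, φ.map_adj_iff]
    obtain ⟨a, b, hab⟩ := affine_of_sub_mem h0 hne hSc π hpres
    refine ⟨a, b, ?_, ?_, ?_⟩
    · rintro rfl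
      exact one_ne_zero (π.injective (show π 1 = π 0 by rw [hab, hab]; ring))
    · intro x hx
      have := (hpres x 0).2 (by simpa using hx)
      rw [hab, hab] at this
      simpa using this
    · intro x; rw [hπe, hab]
  have hhom : ∀ d ∈ S, ∀ d' ∈ S, ∃ a, a * d = d' ∧ ∀ x ∈ S, a * x ∈ S := by
    intro d hd d' hd'
    have hgeo : ∀ d ∈ S, Is2Geodesic Γ (e 0) v (e d) := by
      intro d hd
      rw [memS] at hd
      exact ⟨(e 0).2.symm, (e d).2, fun h => hd.1 (e.injective (Subtype.ext h)).symm, hd.2⟩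
    obtain ⟨φ, h1, h2, h3⟩ := h2gt.2 (hgeo d hd) (hgeo d' hd')
    obtain ⟨a, b, -, haS, hab⟩ := haff φ h2
    rw [hab] at h1 h3
    have h1 := e.injective (Subtype.ext h1)
    have h3 := e.injective (Subtype.ext h3)
    exact ⟨a, by linear_combination h3 - h1, haS⟩
  obtain ⟨hdvd, ε, hε, hSε⟩ := exists_mem_iff_pow_eq h0 hne hhom
  rw [hSk] at hdvd
  simp only [hSk] at hSε
  refine ⟨hdvd, ⟨⟨e, ε, hε, ?_, ?_, ?_, ?_⟩⟩⟩
  · rw [← hSk]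
    congr 1
    ext x
    rw [Finset.mem_filter, hSk, hSε]
    simp
  · rw [← hSk]
    refine pow_card_eq_one_of_mul_mem h0 (neg_ne_zero.2 one_ne_zero) fun x hx => ?_
    have hx0 : x ≠ 0 := fun h => h0 (h ▸ hx)
    have := (hnadj 0 x hx0.symm).2 (by simpa using hx)
    rw [Γ.adj_comm, hnadj _ _ hx0] at this
    simpa using this
  · intro i j hij
    rw [hnadj i j hij, hSε]
  · intro φ hφ
    obtain ⟨a, b, ha, haS, hab⟩ := haff φ hφ
    exact ⟨a, b, hSk ▸ pow_card_eq_one_of_mul_mem h0 ha haS, hab⟩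

theorem PaleyCoords.adj_iff {V : Type*} {Γ : SimpleGraph V} {u : V} {p k : ℕ} [NeZero p]
    (C : PaleyCoords Γ u p k) (i j : ZMod p) :
    Γ.Adj (C.e i) (C.e j) ↔ j ≠ i ∧ (j - i) ^ k ≠ C.ε := by
  by_cases h : i = j
  · subst h; simp
  · rw [Ne, Ne, ← C.not_adj_iff i j h, not_not]
    exact ⟨fun h' => ⟨fun h'' => h h''.symm, h'⟩, fun h' => h'.2⟩

theorem PaleyCoords.exists_eq {V : Type*} {Γ : SimpleGraph V} {u v : V} {p k : ℕ} [NeZero p]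
    (C : PaleyCoords Γ u p k) (h : Γ.Adj u v) : ∃ i, (C.e i : V) = v :=
  ⟨C.e.symm ⟨v, h⟩, by simp⟩

theorem PaleyCoords.adj_e {V : Type*} {Γ : SimpleGraph V} {u : V} {p k : ℕ} [NeZero p]
    (C : PaleyCoords Γ u p k) (i : ZMod p) : Γ.Adj u (C.e i) := (C.e i).2

theorem PaleyCoords.e_injective {V : Type*} {Γ : SimpleGraph V} {u : V} {p k : ℕ} [NeZero p]
    (C : PaleyCoords Γ u p k) : Function.Injective fun i => (C.e i : V) :=
  Subtype.val_injective.comp C.e.injective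

theorem PaleyCoords.card_filter_e {V : Type*} [Fintype V] {Γ : SimpleGraph V} {u : V} {p k : ℕ}
    [NeZero p] (C : PaleyCoords Γ u p k) (P : V → Prop)
    [DecidablePred fun x => Γ.Adj u x ∧ P x] [DecidablePred fun i => P (C.e i)] :
    (Finset.univ.filter fun x => Γ.Adj u x ∧ P x).card =
      (Finset.univ.filter fun i => P (C.e i)).card := by
  refine (Finset.card_bij (fun i _ => (C.e i : V)) ?_ ?_ ?_).symm
  · intro i hi
    simp only [Finset.mem_filter, Finset.mem_univ, true_and] at hi ⊢
    exact ⟨C.adj_e i, hi⟩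
  · intro i _ j _ h; exact C.e_injective h
  · intro x hx
    simp only [Finset.mem_filter, Finset.mem_univ, true_and] at hx
    obtain ⟨i, rfl⟩ := C.exists_eq hx.1
    exact ⟨i, by simpa using hx.2, rfl⟩

open Classical in
theorem PaleyCoords.card_common {V : Type*} [Fintype V] {Γ : SimpleGraph V} {u : V}
    {p k : ℕ} [Fact p.Prime] (C : PaleyCoords Γ u p k) {v w : V} (h : Is2Geodesic Γ v u w) :
    ∃ d, d ^ k = C.ε ∧ (Finset.univ.filter fun x => Γ.Adj u x ∧ Γ.Adj v x ∧ Γ.Adj w x).card =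
      (Finset.univ.filter fun x : ZMod p =>
        (x ≠ 0 ∧ x ^ k ≠ C.ε) ∧ x ≠ d ∧ (x - d) ^ k ≠ C.ε).card := by
  obtain ⟨hvu, huw, hvw, hn⟩ := h
  obtain ⟨i, rfl⟩ := C.exists_eq hvu.symm
  obtain ⟨j, rfl⟩ := C.exists_eq huw
  have hij : i ≠ j := fun h => hvw (by rw [h])
  refine ⟨j - i, (C.not_adj_iff i j hij).1 hn, ?_⟩
  rw [C.card_filter_e fun x => Γ.Adj (C.e i) x ∧ Γ.Adj (C.e j) x]
  simp only [C.adj_iff]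
  refine Finset.card_bij' (fun x _ => x - i) (fun x _ => x + i) ?_ ?_ ?_ ?_
  · intro x hx
    simp only [Finset.mem_filter, Finset.mem_univ, true_and] at hx ⊢
    rw [sub_ne_zero, sub_sub_sub_cancel_right, ne_eq (x - i), sub_left_inj]
    exact hx
  · intro x hx
    simp only [Finset.mem_filter, Finset.mem_univ, true_and] at hx ⊢
    rw [add_sub_cancel_right, show x + i - j = x - (j - i) by ring, add_ne_right,
      ne_eq (x + i), ← eq_sub_iff_add_eq]
    exact hx
  · intro x _; ring
  · intro x _; ring

theorem PaleyCoords.le_card_common {V : Type*} {Γ : SimpleGraph V} {u : V}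
    {p k : ℕ} [Fact p.Prime] (C : PaleyCoords Γ u p k) {d : ZMod p}
    (hd : d ^ k = C.ε) :
    p ≤ 2 * k + (Finset.univ.filter fun x : ZMod p =>
        (x ≠ 0 ∧ x ^ k ≠ C.ε) ∧ x ≠ d ∧ (x - d) ^ k ≠ C.ε).card := by
  set A := Finset.univ.filter fun x : ZMod p => x ^ k = C.ε with hA
  set B := Finset.univ.filter fun x : ZMod p => (x - d) ^ k = C.ε with hB
  set D := Finset.univ.filter fun x : ZMod p =>
        (x ≠ 0 ∧ x ^ k ≠ C.ε) ∧ x ≠ d ∧ (x - d) ^ k ≠ C.ε with hD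
  have hBk : B.card = k := by
    rw [← C.card_eq]
    exact Finset.card_bij' (fun x _ => x - d) (fun x _ => x + d) (by simp [hB]) (by simp [hB])
      (by simp) (by simp)
  have hU : (A ∪ B) ∪ D = Finset.univ := by
    ext x
    simp only [hA, hB, hD, Finset.mem_union, Finset.mem_filter, Finset.mem_univ, true_and, iff_true]
    by_cases h1 : x = 0
    · subst h1
      left; right
      rw [zero_sub, ← neg_one_mul, mul_pow, C.neg_one_pow, one_mul, hd]
    · by_cases h2 : x = d
      · subst h2; exact Or.inl (Or.inl hd)
      · tauto
  have h1 := Finset.card_union_le (A ∪ B) D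
  have h2 := Finset.card_union_le A B
  rw [hU, Finset.card_univ, ZMod.card] at h1
  have h3 : A.card = k := C.card_eq
  omega

theorem PaleyCoords.exists_adj_not_adj {V : Type*} {Γ : SimpleGraph V} {u : V}
    {p k : ℕ} [Fact p.Prime] (C : PaleyCoords Γ u p k) (hk : k < p - 1) {v w : V}
    (h : Is2Geodesic Γ v u w) : ∃ x, Γ.Adj v x ∧ ¬ Γ.Adj x w := by
  obtain ⟨hvu, huw, hvw, hn⟩ := h
  obtain ⟨i, rfl⟩ := C.exists_eq hvu.symm
  obtain ⟨j, rfl⟩ := C.exists_eq huw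
  have hij : j - i ≠ 0 := sub_ne_zero.2 fun h => hvw (by rw [h])
  by_contra! hcon
  obtain ⟨t, ht0, ht⟩ : ∃ t : ZMod p, t ≠ 0 ∧ t ^ k ≠ C.ε := by
    by_contra! hcon
    have hsub : Finset.univ ⊆ insert 0 (Finset.univ.filter fun x : ZMod p => x ^ k = C.ε) := by
      intro x _
      by_cases hx : x = 0
      · simp [hx]
      · simp [hcon x hx]
    have h1 := (Finset.card_le_card hsub).trans (Finset.card_insert_le _ _)
    rw [C.card_eq, Finset.card_univ, ZMod.card] at h1
    omega
  have hstep : ∀ y : ZMod p, y ≠ 0 ∧ y ^ k ≠ C.ε →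
      (y - (j - i)) ≠ 0 ∧ (y - (j - i)) ^ k ≠ C.ε := by
    rintro y ⟨hy0, hy⟩
    have h1 := hcon (C.e (y + i)) ((C.adj_iff _ _).2 ⟨by simpa using hy0, by simpa using hy⟩)
    rw [Γ.adj_comm, C.adj_iff, ← sub_ne_zero] at h1
    rwa [show y - (j - i) = y + i - j by ring]
  have hiter : ∀ n : ℕ, (t - n * (j - i)) ≠ 0 ∧ (t - n * (j - i)) ^ k ≠ C.ε := by
    intro n
    induction n with
    | zero => simpa using ⟨ht0, ht⟩
    | succ n ih =>
      have := hstep _ ih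
      rwa [show t - ((n + 1 : ℕ) : ZMod p) * (j - i) = t - n * (j - i) - (j - i) by
        push_cast; ring]
  refine (hiter (t / (j - i)).val).1 ?_
  rw [ZMod.natCast_zmod_val, div_mul_cancel₀ _ hij, sub_self]

theorem eq_two_mul_add_one_of_dvd {p k c : ℕ} (hp : p.Prime) (hkp : k < p - 1)
    (hdvd : k ∣ p - 1) (hc0 : 0 < c) (hcp : c < p) (hc : c ∣ p * k)
    (hle : p + 1 ≤ 2 * k + c) (hk : k ≠ 0) : p = 2 * k + 1 ∧ c ∣ k := by
  have hck : c ∣ k := by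
    refine Nat.Coprime.dvd_of_dvd_mul_left ?_ hc
    exact (Nat.coprime_of_lt_prime (by omega) hcp hp).symm
  have hle2 := Nat.le_of_dvd (Nat.pos_of_ne_zero hk) hck
  obtain ⟨m, hm⟩ := hdvd
  refine ⟨?_, hck⟩
  have hm2 : m = 2 := by
    have h1 : 1 < m := by
      by_contra! h
      interval_cases m <;> omega
    have h2 : m < 3 := by
      by_contra! h
      have : k * 3 ≤ k * m := Nat.mul_le_mul_left k h
      omega
    omega
  subst hm2
  omega

theorem PaleyCoords.ε_sq {V : Type*} {Γ : SimpleGraph V} {u : V} {p k : ℕ} [Fact p.Prime]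
    (C : PaleyCoords Γ u p k) (hk : k ≠ 0) (hpk : p = 2 * k + 1) : C.ε ^ 2 = 1 := by
  obtain ⟨d, hd⟩ := Finset.card_pos.1 (C.card_eq.symm ▸ Nat.pos_of_ne_zero hk)
  have hd : d ^ k = C.ε := by simpa using hd
  have hd0 : d ≠ 0 := by
    rintro rfl; rw [zero_pow hk] at hd; exact C.ε_ne_zero hd.symm
  rw [← hd, ← pow_mul, ← ZMod.pow_card_sub_one_eq_one hd0]
  congr 1; omega

theorem PaleyCoords.pow_eq_neg_iff {V : Type*} {Γ : SimpleGraph V} {u : V} {p k : ℕ}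
    [Fact p.Prime] (C : PaleyCoords Γ u p k) (hk : k ≠ 0) (hpk : p = 2 * k + 1) (x : ZMod p) :
    x ^ k = -C.ε ↔ x ≠ 0 ∧ x ^ k ≠ C.ε := by
  constructor
  · intro h
    refine ⟨?_, fun h' => neg_ne_self_of_sq_eq_one hpk (C.ε_sq hk hpk) (h.symm.trans h')⟩
    rintro rfl
    rw [zero_pow hk] at h
    exact C.ε_ne_zero (neg_eq_zero.1 h.symm)
  · rintro ⟨h0, h1⟩
    exact (pow_eq_or_eq_neg hpk (C.ε_sq hk hpk) h0).resolve_left h1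

theorem PaleyCoords.adj_iff_pow_eq_neg {V : Type*} {Γ : SimpleGraph V} {u : V} {p k : ℕ}
    [Fact p.Prime] (C : PaleyCoords Γ u p k) (hk : k ≠ 0) (hpk : p = 2 * k + 1) (i j : ZMod p) :
    Γ.Adj (C.e i) (C.e j) ↔ (j - i) ^ k = -C.ε := by
  rw [C.adj_iff, C.pow_eq_neg_iff hk hpk, sub_ne_zero]

open Classical in
theorem PaleyCoords.two_mul_card_common {V : Type*} [Fintype V] {Γ : SimpleGraph V} {u : V}
    {p k : ℕ} [Fact p.Prime] (C : PaleyCoords Γ u p k) (hk : k ≠ 0) (hpk : p = 2 * k + 1)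
    {v w : V} (h : Is2Geodesic Γ v u w) :
    2 * (Finset.univ.filter fun x => Γ.Adj u x ∧ Γ.Adj v x ∧ Γ.Adj w x).card = k := by
  obtain ⟨d, hd, hc⟩ := C.card_common h
  rw [hc]
  refine Eq.trans ?_ (_root_.two_mul_card_common hpk hk (C.ε_sq hk hpk) C.card_eq C.neg_one_pow hd)
  congr 2
  refine Finset.filter_congr fun x _ => ?_
  rw [C.pow_eq_neg_iff hk hpk, C.pow_eq_neg_iff hk hpk, sub_ne_zero]

open Classical in
theorem card_common_add_one_le {V : Type*} [Fintype V] {Γ : SimpleGraph V} {v u w : V}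
    (h : Is2Geodesic Γ v u w) :
    (Finset.univ.filter fun x => Γ.Adj u x ∧ Γ.Adj v x ∧ Γ.Adj w x).card + 1 ≤
      (Finset.univ.filter fun x => Γ.Adj v x ∧ Γ.Adj w x).card := by
  rw [← Finset.card_insert_of_notMem (a := u) (by simp)]
  refine Finset.card_le_card fun x hx => ?_
  simp only [Finset.mem_insert, Finset.mem_filter, Finset.mem_univ, true_and] at hx ⊢
  rcases hx with rfl | hx
  · exact ⟨h.1, h.2.1.symm⟩
  · exact hx.2

theorem exists_is2Geodesic {V : Type*} {Γ : SimpleGraph V} (hconn : Γ.Connected) (hnc : Γ ≠ ⊤) :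
    ∃ v u w, Is2Geodesic Γ v u w := by
  by_contra! hcon
  refine hnc (eq_top_iff.2 fun v w hvw => ?_)
  have key : ∀ {a b : V}, Γ.Walk a b → a = b ∨ Γ.Adj a b := by
    intro a b q
    induction q with
    | nil => exact Or.inl rfl
    | @cons a x b hax _ ih =>
      rcases ih with rfl | hxb
      · exact Or.inr hax
      · by_contra! h
        exact hcon a x b ⟨hax, hxb, h.1, h.2⟩
  obtain ⟨q⟩ := hconn.preconnected v w
  exact (key q).resolve_left hvw

theorem exists_triangle {V : Type*} {Γ : SimpleGraph V} (h2gt : TwoGeodesicTransitive Γ)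
    (h2at : ¬ TwoArcTransitive Γ) : ∃ v u w, Γ.Adj v u ∧ Γ.Adj u w ∧ Γ.Adj v w := by
  by_contra! hcon
  exact h2at ⟨h2gt.1, fun v u w v' u' w' h h' =>
    h2gt.2 ⟨h.1, h.2.1, h.2.2, hcon v u w h.1 h.2.1⟩ ⟨h'.1, h'.2.1, h'.2.2, hcon _ _ _ h'.1 h'.2.1⟩⟩

open Classical in
theorem card_filter_adj {V : Type*} [Fintype V] (Γ : SimpleGraph V) (v : V) :
    (Finset.univ.filter fun x => Γ.Adj v x).card = Nat.card (Γ.neighborSet v) := by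
  rw [Nat.card_eq_fintype_card, ← Set.toFinset_card]
  congr 1
  ext x; simp

open Classical in
theorem TwoGeodesicTransitive.exists_params {V : Type*} [Fintype V] {Γ : SimpleGraph V} {p : ℕ}
    [Fact p.Prime] (hreg : ∀ v : V, Nat.card (Γ.neighborSet v) = p)
    (hconn : Γ.Connected) (hnc : Γ ≠ ⊤) (h2gt : TwoGeodesicTransitive Γ)
    (h2at : ¬ TwoArcTransitive Γ) :
    ∃ k, k ≠ 0 ∧ p = 2 * k + 1 ∧ (∀ v, Nonempty (PaleyCoords Γ v p k)) ∧
      (∀ v u w, Is2Geodesic Γ v u w →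
        (Finset.univ.filter fun x => Γ.Adj v x ∧ Γ.Adj w x).card = k) ∧
      ∀ v, (Finset.univ.filter fun w => ∃ u, Is2Geodesic Γ v u w).card = p := by
  have hp : p.Prime := Fact.out
  obtain ⟨v₀, u₀, w₀, h₀⟩ := exists_is2Geodesic hconn hnc
  obtain ⟨v₁, u₁, w₁, hvu₁, huw₁, hvw₁⟩ := exists_triangle h2gt h2at
  obtain ⟨k, hk⟩ : ∃ k, ∀ v u, Γ.Adj v u →
      (Finset.univ.filter fun w => Γ.Adj u w ∧ v ≠ w ∧ ¬ Γ.Adj v w).card = k := by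
    refine ⟨(Finset.univ.filter fun w => Γ.Adj u₀ w ∧ v₀ ≠ w ∧ ¬ Γ.Adj v₀ w).card, fun v u h => ?_⟩
    obtain ⟨φ, hv, hu⟩ := h2gt.1 h h₀.1
    rw [← hv, ← hu]
    refine Finset.card_equiv φ.toEquiv fun w => ?_
    simp [φ.map_adj_iff]
  obtain ⟨c, hc⟩ : ∃ c, ∀ v u w, Is2Geodesic Γ v u w →
      (Finset.univ.filter fun x => Γ.Adj v x ∧ Γ.Adj w x).card = c := by
    refine ⟨(Finset.univ.filter fun x => Γ.Adj v₀ x ∧ Γ.Adj w₀ x).card, fun v u w h => ?_⟩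
    obtain ⟨φ, hv, -, hw⟩ := h2gt.2 h h₀
    rw [← hv, ← hw]
    refine Finset.card_equiv φ.toEquiv fun w => ?_
    simp [φ.map_adj_iff]
  have hk0 : k ≠ 0 := by
    rw [← hk v₀ u₀ h₀.1]
    exact (Finset.card_pos.2 ⟨w₀, by simpa using ⟨h₀.2.1, h₀.2.2.1, h₀.2.2.2⟩⟩).ne'
  have hkp : k < p - 1 := by
    have hlt : (Finset.univ.filter fun w => Γ.Adj u₁ w ∧ v₁ ≠ w ∧ ¬ Γ.Adj v₁ w).card <
        ((Finset.univ.filter fun w => Γ.Adj u₁ w).erase v₁).card := by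
      refine Finset.card_lt_card (Finset.ssubset_iff_subset_ne.2 ⟨fun x hx => ?_, fun h => ?_⟩)
      · simp only [Finset.mem_filter, Finset.mem_univ, true_and, Finset.mem_erase] at hx ⊢
        exact ⟨hx.2.1.symm, hx.1⟩
      · have : w₁ ∈ (Finset.univ.filter fun w => Γ.Adj u₁ w).erase v₁ := by
          simpa using ⟨hvw₁.ne', huw₁⟩
        rw [← h] at this
        simp [hvw₁] at this
    rw [hk _ _ hvu₁, Finset.card_erase_of_mem (by simpa using hvu₁.symm), card_filter_adj,
      hreg] at hlt
    exact hlt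
  have hcoords := fun v => h2gt.nonempty_paleyCoords (hreg v) hk0 hkp hk
  have hcount : ∀ v, p * k = (Finset.univ.filter fun w => ∃ u, Is2Geodesic Γ v u w).card * c := by
    intro v
    rw [← hreg v, ← card_filter_adj]
    refine Finset.card_mul_eq_card_mul Γ.Adj (fun u hu => ?_) fun w hw => ?_
    · have hu : Γ.Adj v u := by simpa using hu
      rw [← hk v u hu, Finset.bipartiteAbove, Finset.filter_filter]
      congr 1
      refine Finset.filter_congr fun w _ => ⟨?_, ?_⟩
      · rintro ⟨⟨x, hx⟩, huw⟩
        exact ⟨huw, hx.2.2⟩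
      · rintro ⟨huw, h⟩
        exact ⟨⟨u, hu, huw, h⟩, huw⟩
    · obtain ⟨u, hu⟩ : ∃ u, Is2Geodesic Γ v u w := by simpa using hw
      rw [← hc v u w hu, Finset.bipartiteBelow, Finset.filter_filter]
      simp only [Γ.adj_comm w]
  obtain ⟨hdvd, ⟨C⟩⟩ := hcoords u₀
  have hcle := card_common_add_one_le h₀
  rw [hc _ _ _ h₀] at hcle
  have hcp : c < p := by
    obtain ⟨x, hx1, hx2⟩ := C.exists_adj_not_adj hkp h₀
    rw [← hc _ _ _ h₀, ← hreg v₀, ← card_filter_adj]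
    refine Finset.card_lt_card (Finset.ssubset_iff_subset_ne.2 ⟨fun y hy => ?_, fun h => ?_⟩)
    · simp only [Finset.mem_filter, Finset.mem_univ, true_and] at hy ⊢
      exact hy.1
    · have : x ∈ Finset.univ.filter fun y => Γ.Adj v₀ y := by simpa using hx1
      rw [← h] at this
      simp only [Finset.mem_filter, Finset.mem_univ, true_and] at this
      exact hx2 this.2.symm
  obtain ⟨hpk, hck⟩ : p = 2 * k + 1 ∧ c ∣ k := by
    obtain ⟨d, hd, hd'⟩ := C.card_common h₀
    have := C.le_card_common hd
    exact eq_two_mul_add_one_of_dvd hp hkp hdvd (by omega) hcp ⟨_, (hcount v₀).trans (mul_comm _ _)⟩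
      (by omega) hk0
  have hck' : c = k := by
    have h1 := C.two_mul_card_common hk0 hpk h₀
    obtain ⟨m, hm⟩ := hck
    have hm1 : m = 1 := by
      have : m < 2 := by
        by_contra! h
        have : c * 2 ≤ c * m := Nat.mul_le_mul_left c h
        omega
      interval_cases m
      · omega
      · rfl
    rw [hm, hm1, mul_one]
  subst hck'
  exact ⟨c, hk0, hpk, fun v => (hcoords v).2, hc, fun v =>
    (Nat.eq_of_mul_eq_mul_right (Nat.pos_of_ne_zero hk0) (hcount v)).symm⟩

theorem Is2Geodesic.symm {V : Type*} {Γ : SimpleGraph V} {v u w : V} (h : Is2Geodesic Γ v u w) :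
    Is2Geodesic Γ w u v :=
  ⟨h.2.1.symm, h.1.symm, h.2.2.1.symm, fun h' => h.2.2.2 h'.symm⟩

open Classical in
/-- The centroid of `B` is fixed by every affine bijection preserving `B`. -/
theorem exists_fixed_of_affine_mem {F : Type*} [Field F] (B : Finset F) (hB : (B.card : F) ≠ 0) :
    ∃ c : F, ∀ a b : F, a ≠ 0 → (∀ x ∈ B, a * x + b ∈ B) → a * c + b = c := by
  refine ⟨(∑ x ∈ B, x) / B.card, fun a b ha h => ?_⟩
  have hinj : Set.InjOn (fun x => a * x + b) B := fun x _ y _ hxy =>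
    mul_left_cancel₀ ha (add_right_cancel hxy)
  have hsum : ∑ x ∈ B, (a * x + b) = ∑ x ∈ B, x :=
    Finset.sum_nbij (fun x => a * x + b) h hinj (Finset.surjOn_of_injOn_of_card_le _ h hinj le_rfl)
      fun _ _ => rfl
  rw [Finset.sum_add_distrib, ← Finset.mul_sum, Finset.sum_const, nsmul_eq_mul] at hsum
  field_simp
  linear_combination hsum

open Classical in
theorem PaleyCoords.exists_adj_iff_sub_pow {V : Type*} [Fintype V] {Γ : SimpleGraph V} {v u w : V}
    {p k : ℕ} [Fact p.Prime] (C : PaleyCoords Γ w p k) (hk : k ≠ 0) (hpk : p = 2 * k + 1)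
    (h2gt : TwoGeodesicTransitive Γ) (hcoords : ∀ x, Nonempty (PaleyCoords Γ x p k))
    (hcommon : ∀ v u w, Is2Geodesic Γ v u w →
      (Finset.univ.filter fun x => Γ.Adj v x ∧ Γ.Adj w x).card = k)
    (h : Is2Geodesic Γ v u w) :
    ∃ c, ∀ x, Γ.Adj v (C.e x) ↔ (x - c) ^ k = C.ε := by
  have hε := C.ε_sq hk hpk
  have hgeo : ∀ b, Γ.Adj v (C.e b) → Is2Geodesic Γ v (C.e b) w := fun b hb =>
    ⟨hb, (C.adj_e b).symm, h.2.2⟩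
  set B : Finset (ZMod p) := Finset.univ.filter fun x => Γ.Adj v (C.e x) with hB
  have memB : ∀ x, x ∈ B ↔ Γ.Adj v (C.e x) := by simp [hB]
  have hBk : B.card = k := by
    rw [← hcommon _ _ _ h.symm, C.card_filter_e fun x => Γ.Adj v x]
  have hBk0 : (B.card : ZMod p) ≠ 0 := by
    rw [hBk, Ne, ZMod.natCast_eq_zero_iff]
    intro hdvd
    have := Nat.le_of_dvd (Nat.pos_of_ne_zero hk) hdvd
    omega
  obtain ⟨c, hc⟩ := exists_fixed_of_affine_mem B hBk0
  have hconst : ∀ b ∈ B, ∀ b' ∈ B, (b - c) ^ k = (b' - c) ^ k := by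
    intro b hb b' hb'
    obtain ⟨φ, hv, hbb, hw⟩ := h2gt.2 (hgeo b ((memB b).1 hb)) (hgeo b' ((memB b').1 hb'))
    obtain ⟨a, t, ha, hat⟩ := C.affine φ hw
    have ha0 : a ≠ 0 := by rintro rfl; rw [zero_pow hk] at ha; exact zero_ne_one ha
    have hfix := hc a t ha0 fun x hx => by
      rw [memB] at hx ⊢
      rwa [← hat, ← hv, φ.map_adj_iff]
    rw [hat] at hbb
    have hbb' : a * b + t = b' := C.e_injective hbb
    rw [show b' - c = a * (b - c) by linear_combination hfix - hbb', mul_pow, ha, one_mul]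
  obtain ⟨b, hb⟩ := Finset.card_pos.1 (hBk.symm ▸ Nat.pos_of_ne_zero hk)
  have hcount : ∀ δ : ZMod p, (Finset.univ.filter fun x : ZMod p => x ^ k = δ).card = k →
      (b - c) ^ k = δ → ∀ x, Γ.Adj v (C.e x) ↔ (x - c) ^ k = δ := by
    intro δ hδ hbδ
    have : B = Finset.univ.filter fun x : ZMod p => (x - c) ^ k = δ := by
      refine Finset.eq_of_subset_of_card_le (fun x hx => ?_) ?_
      · simpa [hbδ] using hconst x hx b hb
      · refine le_of_eq (Eq.trans ?_ (hδ.trans hBk.symm))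
        exact (Finset.card_bij' (fun x _ => x - c) (fun x _ => x + c) (by simp) (by simp)
          (by simp) (by simp))
    intro x
    rw [← memB, this]; simp
  have hcount_mid := (hcoords (C.e b)).some.two_mul_card_common hk hpk (hgeo b ((memB b).1 hb))
  have hbc : b - c ≠ 0 := by
    intro h0
    have hsub : B ⊆ {c} := by
      intro x hx
      have := hconst x hx b hb
      rw [h0, zero_pow hk] at this
      rw [Finset.mem_singleton]
      exact sub_eq_zero.1 (pow_eq_zero_iff hk |>.1 this)
    have := Finset.card_le_card hsub
    rw [hBk, Finset.card_singleton] at this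
    omega
  rcases pow_eq_or_eq_neg hpk hε hbc with hb' | hb'
  · exact ⟨c, hcount _ C.card_eq hb'⟩
  · exfalso
    have hadj := hcount _ (card_filter_pow_eq_neg hpk hk hε C.card_eq) hb'
    have h1 := two_mul_card_common_neg hpk hk hε C.card_eq C.neg_one_pow hb'
    have h2 : (Finset.univ.filter fun x =>
        Γ.Adj (C.e b) x ∧ Γ.Adj v x ∧ Γ.Adj w x).card =
        (Finset.univ.filter fun x : ZMod p => x ^ k = -C.ε ∧ (x - (b - c)) ^ k = -C.ε).card := by
      rw [← Finset.card_bij' (s := Finset.univ.filter fun x : ZMod p =>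
          Γ.Adj (C.e b) (C.e x) ∧ Γ.Adj v (C.e x)) (fun x _ => x - c) (fun x _ => x + c)
          ?_ ?_ (by simp) (by simp), ← C.card_filter_e fun x => Γ.Adj (C.e b) x ∧ Γ.Adj v x]
      · congr 1
        refine Finset.filter_congr fun x _ => by tauto
      · intro x hx
        simp only [Finset.mem_filter, Finset.mem_univ, true_and, hadj,
          C.adj_iff_pow_eq_neg hk hpk] at hx ⊢
        exact ⟨hx.2, by rw [sub_sub_sub_cancel_right]; exact hx.1⟩
      · intro x hx
        simp only [Finset.mem_filter, Finset.mem_univ, true_and, hadj,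
          C.adj_iff_pow_eq_neg hk hpk] at hx ⊢
        exact ⟨by rw [show x + c - b = x - (b - c) by ring]; exact hx.2, by simpa using hx.1⟩
    omega

open Classical in
/-- A vertex `w` at distance two from `v` has at most one neighbour `z` at distance more than two
from `v`, and `z` is adjacent to more than half of the vertices at distance two from `v`. -/
theorem exists_adj_and_forall_adj {V : Type*} [Fintype V] {Γ : SimpleGraph V} {v u w : V}
    {p k : ℕ} [Fact p.Prime] (hk : k ≠ 0) (hpk : p = 2 * k + 1)
    (h2gt : TwoGeodesicTransitive Γ) (hcoords : ∀ x, Nonempty (PaleyCoords Γ x p k))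
    (hcommon : ∀ v u w, Is2Geodesic Γ v u w →
      (Finset.univ.filter fun x => Γ.Adj v x ∧ Γ.Adj w x).card = k)
    (h : Is2Geodesic Γ v u w) :
    ∃ z, (∀ x, Γ.Adj w x → x = z ∨ Γ.Adj v x ∨ ∃ y, Is2Geodesic Γ v y x) ∧
      k + 1 ≤ (Finset.univ.filter fun x => Γ.Adj z x ∧ ∃ y, Is2Geodesic Γ v y x).card := by
  obtain ⟨C⟩ := hcoords w
  have hε := C.ε_sq hk hpk
  obtain ⟨c, hc⟩ := C.exists_adj_iff_sub_pow hk hpk h2gt hcoords hcommon h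
  have hfar : ∀ x, (x - c) ^ k = -C.ε → ∃ y, Is2Geodesic Γ v y (C.e x) := by
    intro x hx
    obtain ⟨s, hs, hs'⟩ := exists_pow_eq_and_sub_pow_eq_neg hpk hk hε C.card_eq C.neg_one_pow hx
    refine ⟨C.e (s + c), (hc _).2 (by simpa using hs), ?_, ?_, ?_⟩
    · rwa [C.adj_iff_pow_eq_neg hk hpk, show x - (s + c) = x - c - s by ring]
    · intro hv
      exact h.2.2.2 (by rw [hv]; exact (C.adj_e x).symm)
    · rw [hc, hx]
      exact neg_ne_self_of_sq_eq_one hpk hε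
  refine ⟨C.e c, fun x hx => ?_, ?_⟩
  · obtain ⟨i, rfl⟩ := C.exists_eq hx
    by_cases hi : i - c = 0
    · exact Or.inl (by rw [sub_eq_zero.1 hi])
    · rcases pow_eq_or_eq_neg hpk hε hi with h1 | h1
      · exact Or.inr (Or.inl ((hc i).2 h1))
      · exact Or.inr (Or.inr (hfar i h1))
  · have hcard : (insert w ((Finset.univ.filter fun x : ZMod p => x ^ k = -C.ε).image
        fun x => (C.e (x + c) : V))).card = k + 1 := by
      rw [Finset.card_insert_of_notMem, Finset.card_image_of_injective,
        card_filter_pow_eq_neg hpk hk hε C.card_eq]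
      · intro x y hxy
        exact add_right_cancel (C.e_injective hxy)
      · simp only [Finset.mem_image, not_exists, not_and]
        intro x _ hx
        exact (C.adj_e (x + c)).ne hx.symm
    rw [← hcard]
    refine Finset.card_le_card (Finset.insert_subset ?_ ?_)
    · simpa using ⟨(C.adj_e c).symm, u, h⟩
    · intro y hy
      simp only [Finset.mem_image, Finset.mem_filter, Finset.mem_univ, true_and] at hy ⊢
      obtain ⟨x, hx, rfl⟩ := hy
      exact ⟨by rw [C.adj_iff_pow_eq_neg hk hpk, add_sub_cancel_right, hx],
        hfar _ (by rw [add_sub_cancel_right, hx])⟩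

theorem SimpleGraph.Connected.forall_of_adj {V : Type*} {Γ : SimpleGraph V}
    (hconn : Γ.Connected) {P : V → Prop} {v : V} (hv : P v)
    (h : ∀ x y, Γ.Adj x y → P x → P y) (w : V) : P w := by
  have key : ∀ {a b : V}, Γ.Walk a b → P a → P b := by
    intro a b q
    induction q with
    | nil => exact id
    | cons hax _ ih => exact fun ha => ih (h _ _ hax ha)
  obtain ⟨q⟩ := hconn.preconnected v w
  exact key q hv

open Classical in
theorem card_eq_two_mul_add_two {V : Type*} [Fintype V] {Γ : SimpleGraph V} {p k : ℕ}
    [Fact p.Prime] (hreg : ∀ v : V, Nat.card (Γ.neighborSet v) = p)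
    (hconn : Γ.Connected) (h2gt : TwoGeodesicTransitive Γ) (hk : k ≠ 0) (hpk : p = 2 * k + 1)
    (hcoords : ∀ x, Nonempty (PaleyCoords Γ x p k))
    (hcommon : ∀ v u w, Is2Geodesic Γ v u w →
      (Finset.univ.filter fun x => Γ.Adj v x ∧ Γ.Adj w x).card = k) (v : V)
    (hD : (Finset.univ.filter fun w => ∃ u, Is2Geodesic Γ v u w).card = p) :
    Nat.card V = 2 * p + 2 := by
  rw [Nat.card_eq_fintype_card]
  have hN : (Finset.univ.filter fun w => Γ.Adj v w).card = p := by rw [card_filter_adj, hreg]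
  have hdisj : Disjoint (Finset.univ.filter fun w => Γ.Adj v w)
      (Finset.univ.filter fun w => ∃ u, Is2Geodesic Γ v u w) := by
    refine Finset.disjoint_filter.2 fun w _ hw => ?_
    rintro ⟨u, hu⟩
    exact hu.2.2.2 hw
  set T := insert v ((Finset.univ.filter fun w => Γ.Adj v w) ∪
    (Finset.univ.filter fun w => ∃ u, Is2Geodesic Γ v u w)) with hT
  have memT : ∀ x, x ∈ T ↔ x = v ∨ Γ.Adj v x ∨ ∃ u, Is2Geodesic Γ v u x := by simp [hT]
  have hTc : T.card = 2 * p + 1 := by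
    rw [hT, Finset.card_insert_of_notMem, Finset.card_union_of_disjoint hdisj, hN, hD, two_mul]
    simp only [Finset.mem_union, Finset.mem_filter, Finset.mem_univ, true_and, not_or, not_exists]
    exact ⟨Γ.irrefl, fun u hu => hu.2.2.1 rfl⟩
  have hstep : ∀ x y, Γ.Adj x y → x = v ∨ Γ.Adj v x → y ∈ T := by
    intro x y hxy hx
    rw [memT]
    rcases hx with rfl | hx
    · exact Or.inr (Or.inl hxy)
    · by_cases h1 : v = y
      · exact Or.inl h1.symm
      · by_cases h2 : Γ.Adj v y
        · exact Or.inr (Or.inl h2)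
        · exact Or.inr (Or.inr ⟨x, hx, hxy, h1, h2⟩)
  have hauto : ∀ φ : Γ ≃g Γ, φ v = v → ∀ x, x ∈ T → φ x ∈ T := by
    intro φ hφ x hx
    rw [memT] at hx ⊢
    rcases hx with rfl | hx | ⟨u, hu⟩
    · exact Or.inl hφ
    · exact Or.inr (Or.inl (by rwa [← hφ, φ.map_adj_iff]))
    · refine Or.inr (Or.inr ⟨φ u, ?_⟩)
      rw [← hφ]
      exact ⟨φ.map_adj_iff.2 hu.1, φ.map_adj_iff.2 hu.2.1, φ.injective.ne hu.2.2.1,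
        fun h => hu.2.2.2 (φ.map_adj_iff.1 h)⟩
  have hodd : Fintype.card V ≠ 2 * p + 1 := by
    intro hV
    have hsum := Γ.sum_degrees_eq_twice_card_edges
    have hdeg : ∀ x, Γ.degree x = p := by
      intro x
      rw [← hreg x, Nat.card_eq_fintype_card, Γ.card_neighborSet_eq_degree]
    simp only [hdeg, Finset.sum_const, Finset.card_univ, hV, smul_eq_mul] at hsum
    have : Odd ((2 * p + 1) * p) := Odd.mul ⟨p, rfl⟩ ⟨k, hpk⟩
    rw [hsum] at this
    exact Nat.not_odd_iff_even.2 (even_two_mul _) this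
  have hout : ∀ u w, Is2Geodesic Γ v u w → ∃ x, Γ.Adj w x ∧ x ∉ T := by
    intro u w h
    by_contra! hcon
    refine hodd ?_
    rw [← hTc, ← Finset.card_univ]
    congr 1
    symm
    refine Finset.eq_univ_iff_forall.2 (hconn.forall_of_adj ((memT v).2 (Or.inl rfl)) ?_)
    intro x y hxy hx
    rcases (memT x).1 hx with hx | hx | ⟨u', h'⟩
    · exact hstep x y hxy (Or.inl hx)
    · exact hstep x y hxy (Or.inr hx)
    · obtain ⟨φ, hv, -, hw⟩ := h2gt.2 h h'
      rw [← φ.apply_symm_apply y]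
      refine hauto φ hv _ (hcon _ ?_)
      rwa [← φ.map_adj_iff, hw, φ.apply_symm_apply]
  have hex : ∀ u w, Is2Geodesic Γ v u w → ∃ z, Γ.Adj w z ∧ z ∉ T ∧
      (∀ x, Γ.Adj w x → x = z ∨ x ∈ T) ∧
      k + 1 ≤ (Finset.univ.filter fun x => Γ.Adj z x ∧ ∃ y, Is2Geodesic Γ v y x).card := by
    intro u w h
    obtain ⟨z, hz, hzc⟩ := exists_adj_and_forall_adj hk hpk h2gt hcoords hcommon h
    have hz' : ∀ x, Γ.Adj w x → x = z ∨ x ∈ T := by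
      intro x hx
      rw [memT]
      rcases hz x hx with h | h
      · exact Or.inl h
      · exact Or.inr (Or.inr h)
    obtain ⟨x, hx, hxT⟩ := hout u w h
    obtain rfl := (hz' x hx).resolve_right hxT
    exact ⟨x, hx, hxT, hz', hzc⟩
  obtain ⟨w₀, hw₀⟩ := Finset.card_pos.1 (hD.symm ▸ (Fact.out : p.Prime).pos)
  obtain ⟨u₀, h₀⟩ : ∃ u, Is2Geodesic Γ v u w₀ := by simpa using hw₀
  obtain ⟨z, -, hzT, -, hzc⟩ := hex _ _ h₀
  have hall : ∀ u w, Is2Geodesic Γ v u w → Γ.Adj w z ∧ ∀ x, Γ.Adj w x → x = z ∨ x ∈ T := by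
    intro u w h
    obtain ⟨z', hwz', hz'T, hz', hz'c⟩ := hex _ _ h
    suffices z = z' by rw [this]; exact ⟨hwz', hz'⟩
    set D := Finset.univ.filter fun w => ∃ u, Is2Geodesic Γ v u w with hDdef
    have hsub : ∀ z, (Finset.univ.filter fun x => Γ.Adj z x ∧ ∃ y, Is2Geodesic Γ v y x) ⊆ D := by
      intro z x hx
      simp only [hDdef, Finset.mem_filter, Finset.mem_univ, true_and] at hx ⊢
      exact hx.2
    obtain ⟨x, hx⟩ := Finset.inter_nonempty_of_card_lt_card_add_card (hsub z) (hsub z')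
      (by omega)
    simp only [Finset.mem_inter, Finset.mem_filter, Finset.mem_univ, true_and] at hx
    obtain ⟨⟨hx1, y, hy⟩, hx2, -⟩ := hx
    obtain ⟨z'', -, -, hz'', -⟩ := hex _ _ hy
    rw [(hz'' z hx1.symm).resolve_right hzT, (hz'' z' hx2.symm).resolve_right hz'T]
  have hNz : (Finset.univ.filter fun w => ∃ u, Is2Geodesic Γ v u w) =
      Finset.univ.filter fun x => Γ.Adj z x := by
    refine Finset.eq_of_subset_of_card_le (fun w hw => ?_) ?_
    · obtain ⟨u, h⟩ : ∃ u, Is2Geodesic Γ v u w := by simpa using hw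
      simpa using (hall u w h).1.symm
    · rw [hD, card_filter_adj, hreg]
  have huniv : insert z T = Finset.univ := by
    refine Finset.eq_univ_iff_forall.2 (hconn.forall_of_adj
      (Finset.mem_insert_of_mem ((memT v).2 (Or.inl rfl))) ?_)
    intro x y hxy hx
    rcases Finset.mem_insert.1 hx with rfl | hx
    · have hy : y ∈ Finset.univ.filter fun y => Γ.Adj x y := by simpa using hxy
      rw [← hNz] at hy
      exact Finset.mem_insert_of_mem ((memT y).2 (Or.inr (Or.inr (by simpa using hy))))
    · rcases (memT x).1 hx with hx | hx | ⟨u, h⟩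
      · exact Finset.mem_insert_of_mem (hstep x y hxy (Or.inl hx))
      · exact Finset.mem_insert_of_mem (hstep x y hxy (Or.inr hx))
      · exact Finset.mem_insert.2 ((hall u x h).2 y hxy)
  rw [← Finset.card_univ, ← huniv, Finset.card_insert_of_notMem hzT, hTc]

theorem stmt14 {V : Type*} [Fintype V] (Γ : SimpleGraph V) (p : ℕ)
    (hp : p.Prime)
    (hreg : ∀ v : V, Nat.card (Γ.neighborSet v) = p)
    (hconn : Γ.Connected)
    (hnc : Γ ≠ ⊤)
    (h2gt : TwoGeodesicTransitive Γ)
    (h2at : ¬ TwoArcTransitive Γ) :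
    Nat.card V = 2 * p + 2 := by
  have := Fact.mk hp
  obtain ⟨k, hk, hpk, hcoords, hcommon, hD⟩ := h2gt.exists_params hreg hconn hnc h2at
  obtain ⟨v⟩ := hconn.nonempty
  exact card_eq_two_mul_add_two hreg hconn h2gt hk hpk hcoords hcommon v (hD v)
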